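/- Let 0 < α < 1, η ≥ 0, t > 0, and let g : [0,∞) → ℝ be continuous. Set μ(ξ) := |ξ|^{(2α−1)/2} and φ(t,ξ) := ∫_0^t μ(ξ) g(s) e^{−(ξ² + η)(t − s)} ds. Then (sin(απ)/π) · ∫_ℝ μ(ξ) φ(t,ξ) dξ = (1/Γ(1 − α)) · ∫_0^t e^{−η(t − s)} (t − s)^{−α} g(s) ds. -/

import Mathlib

open MeasureTheory Real

theorem integral_abs_rpow_mul_exp_neg_mul_sq {α b : ℝ} (hα : 0 < α) (hb : 0 < b) :
    ∫ ξ : ℝ, |ξ| ^ (2 * α - 1) * Real.exp (-b * ξ ^ 2) = b ^ (-α) * Real.Gamma α := by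
  have h := integral_comp_abs (f := fun x : ℝ => x ^ (2 * α - 1) * Real.exp (-b * x ^ (2 : ℝ)))
  rw [integral_rpow_mul_exp_neg_mul_rpow two_pos (by linarith) hb] at h
  simp only [Real.rpow_two, sq_abs] at h
  rw [h, show -(2 * α - 1 + 1) / 2 = -α by ring, show (2 * α - 1 + 1) / 2 = α by ring]
  ring

theorem integrable_abs_rpow_mul_exp_neg_mul_sq {α b : ℝ} (hα : 0 < α) (hb : 0 < b) :
    Integrable fun ξ : ℝ => |ξ| ^ (2 * α - 1) * Real.exp (-b * ξ ^ 2) := by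
  refine Integrable.of_integral_ne_zero ?_
  rw [integral_abs_rpow_mul_exp_neg_mul_sq hα hb]
  exact (mul_pos (Real.rpow_pos_of_pos hb _) (Real.Gamma_pos_of_pos hα)).ne'

/-- The product of the two diffusive weights, with the `ξ`-dependence collected in one Gaussian-type
factor. -/
theorem diffusive_integrand_eq (α η r x ξ : ℝ) :
    |ξ| ^ ((2 * α - 1) / 2) * (|ξ| ^ ((2 * α - 1) / 2) * x * Real.exp (-(ξ ^ 2 + η) * r)) =
      x * Real.exp (-η * r) * (|ξ| ^ (2 * α - 1) * Real.exp (-r * ξ ^ 2)) := by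
  have h1 : |ξ| ^ (2 * α - 1) = |ξ| ^ ((2 * α - 1) / 2) * |ξ| ^ ((2 * α - 1) / 2) := by
    rw [← sq, ← Real.rpow_mul_natCast (abs_nonneg ξ)]
    congr 1
    push_cast
    ring
  have h2 : Real.exp (-(ξ ^ 2 + η) * r) = Real.exp (-η * r) * Real.exp (-r * ξ ^ 2) := by
    rw [← Real.exp_add]
    congr 1
    ring
  rw [h1, h2]
  ring

theorem integrable_diffusive_integrand {α η t : ℝ} (hα0 : 0 < α) (hα1 : α < 1) (ht : 0 < t)
    {g : ℝ → ℝ} (hg : ContinuousOn g (Set.Ici 0)) :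
    Integrable (Function.uncurry fun ξ s : ℝ =>
        g s * Real.exp (-η * (t - s)) * (|ξ| ^ (2 * α - 1) * Real.exp (-(t - s) * ξ ^ 2)))
      (volume.prod (volume.restrict (Set.Ioc 0 t))) := by
  have hne : ∀ᵐ s ∂(volume.restrict (Set.Ioc 0 t)), 0 < t - s := by
    filter_upwards [ae_restrict_mem measurableSet_Ioc,
      ae_restrict_of_ae (volume.ae_ne t)] with s hs hst
    exact sub_pos.2 (lt_of_le_of_ne hs.2 hst)
  have hgm : AEStronglyMeasurable g (volume.restrict (Set.Ioc 0 t)) :=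
    (hg.mono fun s hs => hs.1.le).aestronglyMeasurable measurableSet_Ioc
  have hm : AEStronglyMeasurable (Function.uncurry fun ξ s : ℝ =>
        g s * Real.exp (-η * (t - s)) * (|ξ| ^ (2 * α - 1) * Real.exp (-(t - s) * ξ ^ 2)))
      (volume.prod (volume.restrict (Set.Ioc 0 t))) := by
    have h : Measurable fun p : ℝ × ℝ =>
        Real.exp (-η * (t - p.2)) * (|p.1| ^ (2 * α - 1) * Real.exp (-(t - p.2) * p.1 ^ 2)) := by
      fun_prop
    refine (hgm.comp_snd.mul h.aestronglyMeasurable).congr (Filter.Eventually.of_forall ?_)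
    intro p
    simp only [Function.uncurry, Pi.mul_apply]
    ring
  rw [integrable_prod_iff' hm]
  constructor
  · filter_upwards [hne] with s hs
    exact (integrable_abs_rpow_mul_exp_neg_mul_sq hα0 hs).const_mul (g s * Real.exp (-η * (t - s)))
  · have hI : IntervalIntegrable (fun s : ℝ => (t - s) ^ (-α)) volume 0 t := by
      have h := (intervalIntegral.intervalIntegrable_rpow' (a := t) (b := 0)
        (show -1 < -α by linarith)).comp_sub_left t
      simpa using h
    have hc : ContinuousOn (fun s => |g s * Real.exp (-η * (t - s))| * Real.Gamma α)
        (Set.uIcc 0 t) := by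
      rw [Set.uIcc_of_le ht.le]
      have := hg.mono (fun s (hs : s ∈ Set.Icc 0 t) => hs.1)
      fun_prop
    have hJ := (intervalIntegrable_iff_integrableOn_Ioc_of_le ht.le).1 (hI.mul_continuousOn hc)
    refine Integrable.congr hJ ?_
    filter_upwards [hne] with s hs
    have hnorm : ∀ ξ : ℝ, ‖g s * Real.exp (-η * (t - s)) *
        (|ξ| ^ (2 * α - 1) * Real.exp (-(t - s) * ξ ^ 2))‖ =
        |g s * Real.exp (-η * (t - s))| *
          (|ξ| ^ (2 * α - 1) * Real.exp (-(t - s) * ξ ^ 2)) := fun ξ => by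
      rw [norm_mul, Real.norm_eq_abs, Real.norm_of_nonneg (by positivity)]
    simp only [Function.uncurry, hnorm]
    rw [integral_const_mul, integral_abs_rpow_mul_exp_neg_mul_sq hα0 hs]
    ring

theorem stmt_10 (α η t : ℝ) (hα0 : 0 < α) (hα1 : α < 1) (hη : 0 ≤ η) (ht : 0 < t)
    (g : ℝ → ℝ) (hg : ContinuousOn g (Set.Ici 0)) :
    (Real.sin (α * π) / π) *
        ∫ ξ : ℝ, |ξ| ^ ((2 * α - 1) / 2) *
          ∫ s in Set.Ioc 0 t, |ξ| ^ ((2 * α - 1) / 2) * g s * Real.exp (-(ξ ^ 2 + η) * (t - s)) =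
      (1 / Real.Gamma (1 - α)) *
        ∫ s in Set.Ioc 0 t, Real.exp (-η * (t - s)) * (t - s) ^ (-α) * g s := by
  simp_rw [← integral_const_mul (|_| ^ ((2 * α - 1) / 2)), diffusive_integrand_eq]
  rw [integral_integral_swap (integrable_diffusive_integrand hα0 hα1 ht hg)]
  have hinner : ∫ s in Set.Ioc 0 t, ∫ ξ : ℝ, g s * Real.exp (-η * (t - s)) *
        (|ξ| ^ (2 * α - 1) * Real.exp (-(t - s) * ξ ^ 2)) =
      Real.Gamma α * ∫ s in Set.Ioc 0 t, Real.exp (-η * (t - s)) * (t - s) ^ (-α) * g s := by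
    rw [← integral_const_mul]
    refine integral_congr_ae ?_
    filter_upwards [ae_restrict_mem measurableSet_Ioc,
      ae_restrict_of_ae (volume.ae_ne t)] with s hs hst
    rw [integral_const_mul, integral_abs_rpow_mul_exp_neg_mul_sq hα0
      (sub_pos.2 (lt_of_le_of_ne hs.2 hst))]
    ring
  rw [hinner, ← mul_assoc]
  congr 1
  have hΓ := Real.Gamma_mul_Gamma_one_sub α
  have hΓ1 : Real.Gamma (1 - α) ≠ 0 := (Real.Gamma_pos_of_pos (by linarith)).ne'
  have hsin : Real.sin (α * π) ≠ 0 :=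
    (Real.sin_pos_of_pos_of_lt_pi (by positivity) (by nlinarith [Real.pi_pos])).ne'
  rw [mul_comm π α] at hΓ
  rw [eq_div_iff hΓ1, mul_assoc, hΓ]
  field_simp
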